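/- For every integer n ≥ 2, every prime p, and every real number e with 0 < e < (n+1)/3, there exist infinitely many irreducible polynomials P ∈ ℤ[X] of degree n (i.e., for every H₀ > 0 there exists such a P with H(P) ≥ H₀) that have two distinct roots α ≠ β in the algebraic closure of ℚ_p satisfying |α − β|_p ≤ H(P)^{−e}. In other words, the p-adic root separation exponent for irreducible integer polynomials of degree n is at least (n+1)/3. -/

import Mathlib

open Polynomial

/-- The height of an integer polynomial: the maximum of the absolute values of its
coefficients. -/
def polyHeight (P : Polynomial ℤ) : ℕ :=
  (Finset.range (P.natDegree + 1)).sup fun i => (P.coeff i).natAbs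

/-- The embedding of `ℤ[t]` into the ring of formal power series over `ℚ`. -/
noncomputable def toRatSeries : ℤ[X] →+* PowerSeries ℚ :=
  Polynomial.coeToPowerSeries.ringHom.comp (Polynomial.mapRingHom (Int.castRingHom ℚ))

/-- The operator `a ↦ a' + w a`, i.e. differentiation conjugated by `exp (w t)`. -/
noncomputable def twistedDeriv (w : ℕ) (a : ℤ[X]) : ℤ[X] := derivative a + (w : ℤ[X]) * a

/-- The exponential polynomial `∑ j, ω j ^ l * A j (t) * exp (ω j * t)` as a power series. -/
noncomputable def expMoment {ι : Type*} [Fintype ι] (ω : ι → ℕ) (l : ℕ) (A : ι → ℤ[X]) :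
    PowerSeries ℚ :=
  ∑ j, (ω j : PowerSeries ℚ) ^ l * toRatSeries (A j) * PowerSeries.exp ℚ ^ ω j

theorem derivative_toRatSeries (a : ℤ[X]) :
    PowerSeries.derivative ℚ (toRatSeries a) = toRatSeries (derivative a) := by
  simp only [toRatSeries, RingHom.comp_apply, coe_mapRingHom, coeToPowerSeries.ringHom_apply,
    PowerSeries.derivative_coe, derivative_map]

theorem derivative_expMoment {ι : Type*} [Fintype ι] (ω : ι → ℕ) (l : ℕ) (A : ι → ℤ[X]) :
    PowerSeries.derivative ℚ (expMoment ω l A) =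
      expMoment ω l fun j => twistedDeriv (ω j) (A j) := by
  have hexp (w : ℕ) : PowerSeries.derivative ℚ (PowerSeries.exp ℚ ^ w) =
      (w : PowerSeries ℚ) * PowerSeries.exp ℚ ^ w := by
    rcases w with _ | w
    · simp
    · rw [PowerSeries.derivative_pow, PowerSeries.derivative_exp]
      simp [pow_succ, mul_assoc]
  have hconst (w : ℕ) : PowerSeries.derivative ℚ ((w : PowerSeries ℚ) ^ l) = 0 := by
    rw [← Nat.cast_pow]
    exact Derivation.map_natCast _ _
  unfold expMoment
  rw [map_sum]
  refine Finset.sum_congr rfl fun j _ => ?_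
  rw [Derivation.leibniz, Derivation.leibniz, hexp, hconst, derivative_toRatSeries]
  simp only [twistedDeriv, map_add, map_mul, map_natCast, smul_eq_mul]
  ring

theorem X_pow_dvd_derivative {F : PowerSeries ℚ} {a : ℕ} (h : PowerSeries.X ^ a ∣ F) :
    PowerSeries.X ^ (a - 1) ∣ PowerSeries.derivative ℚ F := by
  rw [PowerSeries.X_pow_dvd_iff] at h ⊢
  intro m hm
  rw [PowerSeries.coeff_derivative, h (m + 1) (by omega), zero_mul]

theorem X_pow_dvd_expMoment_iterate {ι : Type*} [Fintype ι] (ω : ι → ℕ) (l : ℕ) (A : ι → ℤ[X])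
    {a : ℕ} (h : PowerSeries.X ^ a ∣ expMoment ω l A) (i : ℕ) :
    PowerSeries.X ^ (a - i) ∣ expMoment ω l fun j => (twistedDeriv (ω j))^[i] (A j) := by
  induction i with
  | zero => simpa using h
  | succ i ih =>
    simp only [Function.iterate_succ_apply']
    rw [← derivative_expMoment, Nat.sub_add_eq]
    exact X_pow_dvd_derivative ih

theorem natDegree_twistedDeriv_le (w : ℕ) {a : ℤ[X]} {d : ℕ} (h : a.natDegree ≤ d) :
    (twistedDeriv w a).natDegree ≤ d := by
  refine natDegree_add_le_of_degree_le ((natDegree_derivative_le a).trans (by omega)) ?_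
  exact natDegree_mul_le.trans (by simpa using h)

theorem natDegree_twistedDeriv_iterate_le (w : ℕ) {a : ℤ[X]} {d : ℕ} (h : a.natDegree ≤ d)
    (i : ℕ) : ((twistedDeriv w)^[i] a).natDegree ≤ d := by
  induction i with
  | zero => simpa using h
  | succ i ih =>
    rw [Function.iterate_succ_apply']
    exact natDegree_twistedDeriv_le w ih

theorem coeff_twistedDeriv_iterate (w : ℕ) {a : ℤ[X]} {d : ℕ} (h : a.natDegree ≤ d) (i : ℕ) :
    ((twistedDeriv w)^[i] a).coeff d = (w : ℤ) ^ i * a.coeff d := by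
  induction i with
  | zero => simp
  | succ i ih =>
    have hd := natDegree_twistedDeriv_iterate_le w h i
    rw [Function.iterate_succ_apply', twistedDeriv, coeff_add, coeff_derivative,
      coeff_eq_zero_of_natDegree_lt (by omega), ← C_eq_natCast, coeff_C_mul, ih]
    ring

theorem natDegree_prod_le_sum {ι : Type*} {R : Type*} [CommRing R] (s : Finset ι)
    (f : ι → R[X]) (b : ι → ℕ) (h : ∀ i ∈ s, (f i).natDegree ≤ b i) :
    (∏ i ∈ s, f i).natDegree ≤ ∑ i ∈ s, b i :=
  (natDegree_prod_le s f).trans (Finset.sum_le_sum h)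

theorem coeff_prod_sum {ι : Type*} {R : Type*} [CommRing R] (s : Finset ι)
    (f : ι → R[X]) (b : ι → ℕ) (h : ∀ i ∈ s, (f i).natDegree ≤ b i) :
    (∏ i ∈ s, f i).coeff (∑ i ∈ s, b i) = ∏ i ∈ s, (f i).coeff (b i) := by
  classical
  induction s using Finset.induction_on with
  | empty => simp
  | insert i s hi ih =>
    have h' : ∀ i ∈ s, (f i).natDegree ≤ b i := fun i hi => h i (Finset.mem_insert_of_mem hi)
    rw [Finset.prod_insert hi, Finset.sum_insert hi, Finset.prod_insert hi,
      coeff_mul_add_eq_of_natDegree_le (h i (Finset.mem_insert_self i s))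
        (natDegree_prod_le_sum s f b h'), ih h']

theorem natDegree_det_le_sum {m : Type*} [Fintype m] [DecidableEq m] {R : Type*} [CommRing R]
    (M : Matrix m m R[X]) (b : m → ℕ) (h : ∀ i j, (M i j).natDegree ≤ b j) :
    M.det.natDegree ≤ ∑ j, b j := by
  rw [Matrix.det_apply]
  refine natDegree_sum_le_of_forall_le _ _ fun σ _ => ?_
  exact (natDegree_smul_le _ _).trans (natDegree_prod_le_sum _ _ _ fun i _ => h _ _)

theorem coeff_det_sum {m : Type*} [Fintype m] [DecidableEq m] {R : Type*} [CommRing R]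
    (M : Matrix m m R[X]) (b : m → ℕ) (h : ∀ i j, (M i j).natDegree ≤ b j) :
    M.det.coeff (∑ j, b j) = (Matrix.of fun i j => (M i j).coeff (b j)).det := by
  rw [Matrix.det_apply, Matrix.det_apply, finsetSum_coeff]
  refine Finset.sum_congr rfl fun σ _ => ?_
  rw [coeff_smul, coeff_prod_sum _ _ _ fun i _ => h _ _]
  rfl

/-- The Wronskian matrix of the exponential polynomials `A j (t) * exp (ω j * t)`, with the
exponential factors of the columns removed. -/
noncomputable def expWronskian {r : ℕ} (ω : Fin r → ℕ) (A : Fin r → ℤ[X]) :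
    Matrix (Fin r) (Fin r) ℤ[X] :=
  Matrix.of fun i j => (twistedDeriv (ω j))^[i] (A j)

theorem natDegree_det_expWronskian_le {r : ℕ} (ω : Fin r → ℕ) (A : Fin r → ℤ[X]) {d : ℕ}
    (hd : ∀ j, (A j).natDegree ≤ d) : (expWronskian ω A).det.natDegree ≤ r * d := by
  have := natDegree_det_le_sum (expWronskian ω A) (fun _ => d)
    fun i j => natDegree_twistedDeriv_iterate_le _ (hd j) _
  simpa using this

theorem det_expWronskian_ne_zero {r : ℕ} (ω : Fin r → ℕ) (hω : Function.Injective ω)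
    (A : Fin r → ℤ[X]) (hA : ∀ j, A j ≠ 0) : (expWronskian ω A).det ≠ 0 := by
  have key := coeff_det_sum (expWronskian ω A) (fun j => (A j).natDegree)
    fun i j => natDegree_twistedDeriv_iterate_le _ le_rfl _
  have hmat : (Matrix.of fun i j => (expWronskian ω A i j).coeff (A j).natDegree) =
      Matrix.of fun i j => (A j).leadingCoeff *
        (Matrix.vandermonde fun j => (ω j : ℤ)).transpose i j := by
    ext i j
    simp [expWronskian, coeff_twistedDeriv_iterate, Matrix.vandermonde, mul_comm]
  rw [hmat, Matrix.det_mul_row, Matrix.det_transpose] at key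
  intro h0
  rw [h0, coeff_zero, eq_comm, mul_eq_zero, Finset.prod_eq_zero_iff] at key
  rcases key with ⟨j, -, hj⟩ | hV
  · exact hA j (leadingCoeff_eq_zero.mp hj)
  · exact Matrix.det_vandermonde_ne_zero_iff.mpr (Nat.cast_injective.comp hω) hV

theorem sum_le_natDegree_det_expWronskian {r : ℕ} (ω : Fin r → ℕ) (hω : Function.Injective ω)
    (A : Fin r → ℤ[X]) (hA : ∀ j, A j ≠ 0) (a : Fin r → ℕ)
    (ha : ∀ i l : Fin r, PowerSeries.X ^ a l ∣
      expMoment ω l fun j => (twistedDeriv (ω j))^[(i : ℕ)] (A j)) :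
    ∑ l, a l ≤ (expWronskian ω A).det.natDegree := by
  set W := expWronskian ω A with hW
  let V : Matrix (Fin r) (Fin r) (PowerSeries ℚ) :=
    Matrix.of fun j l => PowerSeries.exp ℚ ^ ω j *
      Matrix.vandermonde (fun j => (ω j : PowerSeries ℚ)) j l
  choose q hq using ha
  have hprod : W.map toRatSeries * V =
      Matrix.of fun i l => PowerSeries.X ^ a l * Matrix.of q i l := by
    ext1 i l
    rw [Matrix.of_apply, Matrix.of_apply, ← hq, Matrix.mul_apply, expMoment]
    refine Finset.sum_congr rfl fun j _ => ?_
    simp only [W, V, expWronskian, Matrix.map_apply, Matrix.of_apply, Matrix.vandermonde_apply]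
    ring
  have hdet := congrArg Matrix.det hprod
  rw [Matrix.det_mul, Matrix.det_mul_row, ← RingHom.mapMatrix_apply, ← RingHom.map_det,
    Matrix.det_mul_column] at hdet
  have hV : IsUnit ((∏ j, PowerSeries.exp ℚ ^ ω j) *
      (Matrix.vandermonde fun j => (ω j : PowerSeries ℚ)).det) := by
    refine IsUnit.mul ?_ ?_
    · rw [Finset.prod_pow_eq_pow_sum]
      exact (PowerSeries.isUnit_exp ℚ).pow _
    · have : (Matrix.vandermonde fun j => (ω j : PowerSeries ℚ)).det =
          algebraMap ℚ (PowerSeries ℚ) (Matrix.vandermonde fun j => (ω j : ℚ)).det := by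
        rw [RingHom.map_det]
        congr 1
        ext1 i j
        simp [Matrix.vandermonde]
      rw [this]
      refine IsUnit.map _ (IsUnit.mk0 _ ?_)
      exact Matrix.det_vandermonde_ne_zero_iff.mpr (Nat.cast_injective.comp hω)
  have hdvd : PowerSeries.X ^ (∑ l, a l) ∣ toRatSeries W.det := by
    rw [← hV.dvd_mul_right, hdet, Finset.prod_pow_eq_pow_sum]
    exact dvd_mul_right _ _
  by_contra! hlt
  refine det_expWronskian_ne_zero ω hω A hA (leadingCoeff_eq_zero.mp ?_)
  have := PowerSeries.X_pow_dvd_iff.mp hdvd _ hlt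
  simpa [toRatSeries] using this

theorem toRatSeries_C_mul (c : ℤ) (a : ℤ[X]) :
    toRatSeries (C c * a) = (c : PowerSeries ℚ) * toRatSeries a := by
  rw [map_mul]
  congr 1
  exact map_intCast (toRatSeries.comp C) c

theorem exists_high_order_expMoments (n k d : ℕ) (h : 3 * k < (n + 1) * (d + 1)) :
    ∃ A : Fin (n + 1) → ℤ[X], A ≠ 0 ∧ (∀ j, (A j).natDegree ≤ d) ∧
      PowerSeries.X ^ (2 * k) ∣ expMoment (fun j : Fin (n + 1) => (j : ℕ)) 0 A ∧
      PowerSeries.X ^ k ∣ expMoment (fun j : Fin (n + 1) => (j : ℕ)) 1 A := by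
  let term (l : ℕ) (x : Fin (n + 1) × Fin (d + 1)) : PowerSeries ℚ :=
    (x.1 : PowerSeries ℚ) ^ l * toRatSeries (X ^ (x.2 : ℕ)) * PowerSeries.exp ℚ ^ (x.1 : ℕ)
  let v (x : Fin (n + 1) × Fin (d + 1)) : Fin (2 * k) ⊕ Fin k → ℚ :=
    Sum.elim (fun i => PowerSeries.coeff i (term 0 x)) (fun i => PowerSeries.coeff i (term 1 x))
  have hv : ¬ LinearIndependent ℤ v := by
    rw [LinearIndependent.iff_fractionRing (R := ℤ) (K := ℚ)]
    intro hli
    have := hli.fintype_card_le_finrank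
    simp only [Fintype.card_prod, Fintype.card_fin, Module.finrank_fintype_fun_eq_card,
      Fintype.card_sum] at this
    omega
  obtain ⟨g, hg, x₀, hx₀⟩ := Fintype.not_linearIndependent_iff.mp hv
  let A (j : Fin (n + 1)) : ℤ[X] := ∑ i : Fin (d + 1), C (g (j, i)) * X ^ (i : ℕ)
  have hmoment (l : ℕ) : expMoment (fun j : Fin (n + 1) => (j : ℕ)) l A =
      ∑ x, (g x : PowerSeries ℚ) * term l x := by
    rw [Fintype.sum_prod_type]
    refine Finset.sum_congr rfl fun j _ => ?_
    simp only [A, term, map_sum, toRatSeries_C_mul, Finset.mul_sum, Finset.sum_mul]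
    refine Finset.sum_congr rfl fun i _ => ?_
    ring
  have hcoeff (l i : ℕ) : PowerSeries.coeff i (∑ x, (g x : PowerSeries ℚ) * term l x) =
      ∑ x, (g x : ℚ) * PowerSeries.coeff i (term l x) := by
    rw [map_sum]
    refine Finset.sum_congr rfl fun x _ => ?_
    rw [← PowerSeries.coeff_C_mul]
    simp
  refine ⟨A, fun h0 => hx₀ ?_, fun j => ?_, ?_, ?_⟩
  · have := congrArg (fun a => coeff a (x₀.2 : ℕ)) (congrFun h0 x₀.1)
    simpa [A, finsetSum_coeff, coeff_C_mul, coeff_X_pow, Fin.val_inj] using this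
  · refine natDegree_sum_le_of_forall_le _ _ fun i _ => ?_
    exact (natDegree_C_mul_X_pow_le _ _).trans (by omega)
  · rw [hmoment, PowerSeries.X_pow_dvd_iff]
    intro i hi
    rw [hcoeff]
    simpa [v] using congrFun hg (Sum.inl ⟨i, hi⟩)
  · rw [hmoment, PowerSeries.X_pow_dvd_iff]
    intro i hi
    rw [hcoeff]
    simpa [v] using congrFun hg (Sum.inr ⟨i, hi⟩)

theorem moment_orders_le {r n k d s : ℕ} (ω : Fin r → ℕ) (hω : Function.Injective ω)
    (A : Fin r → ℤ[X]) (hA : ∀ j, A j ≠ 0) (hd : ∀ j, (A j).natDegree ≤ d) (hrn : r ≤ n + 1)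
    (hr : 2 ≤ r) (h0 : PowerSeries.X ^ (2 * k) ∣ expMoment ω 0 A)
    (h1 : PowerSeries.X ^ k ∣ expMoment ω 1 A) (hs : s = 0 ∨ 3 ≤ r)
    (h2 : ∀ i : Fin r, PowerSeries.X ^ s ∣
      expMoment ω 2 fun j => (twistedDeriv (ω j))^[(i : ℕ)] (A j)) :
    2 * k - n + (k - n) + s ≤ r * d := by
  let a (l : ℕ) : ℕ := if l = 0 then 2 * k - n else if l = 1 then k - n else if l = 2 then s else 0
  have key := sum_le_natDegree_det_expWronskian ω hω A hA (fun l => a l) fun i l => by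
    have hi := i.isLt
    by_cases hl0 : (l : ℕ) = 0
    · rw [hl0]
      exact (pow_dvd_pow _ (by simp only [a]; simp; omega)).trans
        (X_pow_dvd_expMoment_iterate ω 0 A h0 i)
    by_cases hl1 : (l : ℕ) = 1
    · rw [hl1]
      exact (pow_dvd_pow _ (by simp only [a]; simp; omega)).trans
        (X_pow_dvd_expMoment_iterate ω 1 A h1 i)
    by_cases hl2 : (l : ℕ) = 2
    · rw [hl2]
      exact h2 i
    · simp [a, hl0, hl1, hl2]
  have hsum : 2 * k - n + (k - n) + s ≤ ∑ l : Fin r, a l := by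
    obtain ⟨r, rfl⟩ : ∃ r', r = r' + 2 := ⟨r - 2, by omega⟩
    rcases hs with rfl | hr3
    · simp only [Fin.sum_univ_succ, Fin.val_succ, Fin.val_zero, a]
      simp
    · obtain ⟨r, rfl⟩ : ∃ r', r = r' + 1 := ⟨r - 1, by omega⟩
      simp only [Fin.sum_univ_succ, Fin.val_succ, Fin.val_zero, a]
      simp
      omega
  exact hsum.trans (key.trans (natDegree_det_expWronskian_le ω A hd))

theorem expMoment_eq_of_support {ι κ : Type*} [Fintype ι] [Fintype κ] (f : κ → ι)
    (hf : Function.Injective f) (ω : ι → ℕ) (l : ℕ) (A : ι → ℤ[X])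
    (hA : ∀ j, A j ≠ 0 → j ∈ Set.range f) :
    expMoment (ω ∘ f) l (A ∘ f) = expMoment ω l A := by
  classical
  unfold expMoment
  refine Fintype.sum_of_injective f hf _ _ (fun j hj => ?_) fun _ => rfl
  rw [not_not.mp (mt (hA j) hj)]
  simp

theorem forall_ne_zero_of_high_order {n k d : ℕ} (hn : 2 ≤ n) (hk : 2 * n * (n + 1) < k)
    (hdk : (n + 1) * d ≤ 3 * k) (A : Fin (n + 1) → ℤ[X]) (hA : A ≠ 0)
    (hd : ∀ j, (A j).natDegree ≤ d)
    (h0 : PowerSeries.X ^ (2 * k) ∣ expMoment (fun j : Fin (n + 1) => (j : ℕ)) 0 A)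
    (h1 : PowerSeries.X ^ k ∣ expMoment (fun j : Fin (n + 1) => (j : ℕ)) 1 A) :
    ∀ j, A j ≠ 0 := by
  classical
  by_contra! hex
  obtain ⟨j₀, hj₀⟩ := hex
  obtain ⟨j₁, hj₁⟩ := Function.ne_iff.mp hA
  set J : Finset (Fin (n + 1)) := Finset.univ.filter fun j => A j ≠ 0 with hJ
  have hJ0 : 0 < J.card := Finset.card_pos.mpr ⟨j₁, by simpa [hJ] using hj₁⟩
  have hJn : J.card ≤ n := by
    have hlt : J.card < (Finset.univ : Finset (Fin (n + 1))).card :=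
      Finset.card_lt_card ((Finset.ssubset_iff_of_subset (Finset.subset_univ _)).mpr
        ⟨j₀, Finset.mem_univ _, by simp [hJ, hj₀]⟩)
    simp at hlt
    omega
  let f : Fin J.card → Fin (n + 1) := fun i => J.equivFin.symm i
  have hf : Function.Injective f := Subtype.val_injective.comp J.equivFin.symm.injective
  have hrange : ∀ j, A j ≠ 0 → j ∈ Set.range f := fun j hj =>
    ⟨J.equivFin ⟨j, by simpa [hJ] using hj⟩, by simp [f]⟩
  have hfne : ∀ i, (A ∘ f) i ≠ 0 := fun i => by
    exact (Finset.mem_filter.mp (J.equivFin.symm i).2).2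
  rw [← expMoment_eq_of_support f hf _ _ _ hrange] at h0 h1
  have hω : Function.Injective ((fun j : Fin (n + 1) => (j : ℕ)) ∘ f) :=
    Fin.val_injective.comp hf
  have hnd : n * d ≤ 3 * k - 3 * n := by
    have : (n + 1) * (n * d) ≤ n * (3 * k) := by nlinarith
    zify [show 3 * n ≤ 3 * k by nlinarith]
    zify at this hk hn
    nlinarith
  by_cases hr : 2 ≤ J.card
  · have := moment_orders_le (s := 0) (n := n) _ hω _ hfne (fun i => hd _) (by omega) hr h0 h1
      (Or.inl rfl) (fun i => by simp)
    have hle : J.card * d ≤ n * d := Nat.mul_le_mul_right d hJn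
    have : n ≤ k := by nlinarith
    omega
  · have hr1 : J.card = 1 := by omega
    have key := sum_le_natDegree_det_expWronskian _ hω _ hfne (fun _ => 2 * k - n) fun i l => by
      have hl : (l : ℕ) = 0 := by omega
      rw [hl]
      exact (pow_dvd_pow _ (by omega)).trans (X_pow_dvd_expMoment_iterate _ 0 _ h0 i)
    have hdeg := key.trans (natDegree_det_expWronskian_le _ _ (d := d) fun i => hd _)
    simp only [Finset.sum_const, Finset.card_univ, Fintype.card_fin, smul_eq_mul, hr1] at hdeg
    have : 3 * d ≤ 3 * k := le_trans (Nat.mul_le_mul_right d (by omega)) hdk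
    have : n < k := by nlinarith
    omega

theorem expMoment_sum_C_mul {ι κ : Type*} [Fintype ι] [Fintype κ] (ω : ι → ℕ) (l : ℕ) (u : κ → ℤ)
    (M : κ → ι → ℤ[X]) :
    expMoment ω l (fun j => ∑ i, C (u i) * M i j) =
      ∑ i, (u i : PowerSeries ℚ) * expMoment ω l (M i) := by
  simp only [expMoment, map_sum, toRatSeries_C_mul, Finset.mul_sum, Finset.sum_mul]
  rw [Finset.sum_comm]
  refine Finset.sum_congr rfl fun i _ => Finset.sum_congr rfl fun j _ => ?_
  ring

theorem expMoment_add_C_mul {ι : Type*} [Fintype ι] (ω : ι → ℕ) (l : ℕ) (c : ℤ)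
    (A B : ι → ℤ[X]) :
    expMoment ω l (fun j => A j + C c * B j) =
      expMoment ω l A + (c : PowerSeries ℚ) * expMoment ω l B := by
  simp only [expMoment, map_add, toRatSeries_C_mul, Finset.mul_sum, ← Finset.sum_add_distrib]
  refine Finset.sum_congr rfl fun j _ => ?_
  ring

theorem exists_pos_eval_ne_zero {W : ℤ[X]} (hW : W ≠ 0) : ∃ N : ℕ, 0 < N ∧ W.eval (N : ℤ) ≠ 0 := by
  by_contra! h
  refine hW (eq_zero_of_infinite_isRoot W ?_)
  refine Set.Infinite.mono ?_ (Set.infinite_range_of_injective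
    (f := fun m : ℕ => ((m + 1 : ℕ) : ℤ)) fun a b hab => by simpa using hab)
  rintro _ ⟨m, rfl⟩
  exact h (m + 1) (Nat.succ_pos m)

theorem exists_eisenstein_family {n k d : ℕ} (p : ℕ) (hn : 2 ≤ n) (hk : 2 * n * (n + 1) < k)
    (hdk : (n + 1) * d ≤ 3 * k) (hkd : 3 * k < (n + 1) * (d + 1)) :
    ∃ (B : Fin (n + 1) → ℤ[X]) (N q : ℕ) (c : ℤ), 0 < N ∧ q.Prime ∧ q ≠ p ∧ ¬ (q : ℤ) ∣ c ∧
      (∀ j, (B j).natDegree ≤ d) ∧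
      PowerSeries.X ^ (2 * k - n) ∣ expMoment (fun j : Fin (n + 1) => (j : ℕ)) 0 B ∧
      PowerSeries.X ^ (k - n) ∣ expMoment (fun j : Fin (n + 1) => (j : ℕ)) 1 B ∧
      ¬ PowerSeries.X ^ (2 * n + 1) ∣ expMoment (fun j : Fin (n + 1) => (j : ℕ)) 2 B ∧
      ∀ j, (q : ℤ) ^ 2 ∣ (B j).eval (N : ℤ) -
        c * (if j = 0 then (q : ℤ) else if j = Fin.last n then 1 else 0) := by
  obtain ⟨A, hA, hd, h0, h1⟩ := exists_high_order_expMoments n k d hkd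
  have hne := forall_ne_zero_of_high_order hn hk hdk A hA hd h0 h1
  set ω : Fin (n + 1) → ℕ := fun j => (j : ℕ) with hωdef
  have hω : Function.Injective ω := Fin.val_injective
  set W := expWronskian ω A with hW
  have hWi (i : Fin (n + 1)) : W i = fun j => (twistedDeriv (ω j))^[(i : ℕ)] (A j) := rfl
  have hW0 (i : Fin (n + 1)) : PowerSeries.X ^ (2 * k - n) ∣ expMoment ω 0 (W i) :=
    (pow_dvd_pow _ (by omega)).trans (X_pow_dvd_expMoment_iterate ω 0 A h0 i)
  have hW1 (i : Fin (n + 1)) : PowerSeries.X ^ (k - n) ∣ expMoment ω 1 (W i) :=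
    (pow_dvd_pow _ (by omega)).trans (X_pow_dvd_expMoment_iterate ω 1 A h1 i)
  have hWd (i j : Fin (n + 1)) : (W i j).natDegree ≤ d :=
    natDegree_twistedDeriv_iterate_le _ (hd j) _
  obtain ⟨i₀, hi₀⟩ : ∃ i, ¬ PowerSeries.X ^ (2 * n + 1) ∣ expMoment ω 2 (W i) := by
    by_contra! hall
    have := moment_orders_le ω hω A hne hd le_rfl (by omega) h0 h1 (Or.inr (by omega)) hall
    have : n < k := by nlinarith
    omega
  obtain ⟨N, hN, hNW⟩ := exists_pos_eval_ne_zero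
    (det_expWronskian_ne_zero ω hω A hne)
  set c := W.det.eval (N : ℤ) with hc
  obtain ⟨q, hqge, hq⟩ := Nat.exists_infinite_primes (c.natAbs + p + 1)
  have hqc : ¬ (q : ℤ) ∣ c := fun hdvd => by
    have := Nat.le_of_dvd (Int.natAbs_pos.mpr hNW) (Int.natCast_dvd.mp hdvd)
    omega
  let v (j : Fin (n + 1)) : ℤ := if j = 0 then (q : ℤ) else if j = Fin.last n then 1 else 0
  let WN : Matrix (Fin (n + 1)) (Fin (n + 1)) ℤ := W.map (evalRingHom (N : ℤ))
  have hWN : WN.det = c := by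
    rw [hc, ← coe_evalRingHom, RingHom.map_det]
    rfl
  let u : Fin (n + 1) → ℤ := Matrix.vecMul v WN.adjugate
  have hu (j : Fin (n + 1)) : ∑ i, u i * (W i j).eval (N : ℤ) = c * v j := by
    have : Matrix.vecMul u WN = WN.det • v := by
      rw [Matrix.vecMul_vecMul, Matrix.adjugate_mul, Matrix.vecMul_smul, Matrix.vecMul_one]
    rw [hWN] at this
    exact congrFun this j
  let R (j : Fin (n + 1)) : ℤ[X] := ∑ i, C (u i) * W i j
  have hR (l : ℕ) : expMoment ω l R = ∑ i, (u i : PowerSeries ℚ) * expMoment ω l (W i) :=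
    expMoment_sum_C_mul ω l u W
  have hR0 : PowerSeries.X ^ (2 * k - n) ∣ expMoment ω 0 R := by
    rw [hR]
    exact Finset.dvd_sum fun i _ => (hW0 i).mul_left _
  have hR1 : PowerSeries.X ^ (k - n) ∣ expMoment ω 1 R := by
    rw [hR]
    exact Finset.dvd_sum fun i _ => (hW1 i).mul_left _
  have hRd (j : Fin (n + 1)) : (R j).natDegree ≤ d :=
    natDegree_sum_le_of_forall_le _ _ fun i _ => (natDegree_C_mul_le _ _).trans (hWd i j)
  have hRN (j : Fin (n + 1)) : (R j).eval (N : ℤ) = c * v j := by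
    rw [← hu]
    simp [R, eval_finsetSum]
  by_cases hR2 : PowerSeries.X ^ (2 * n + 1) ∣ expMoment ω 2 R
  · refine ⟨fun j => R j + C ((q : ℤ) ^ 2) * W i₀ j, N, q, c, hN, hq, by omega, hqc,
      fun j => ?_, ?_, ?_, ?_, fun j => ?_⟩
    · exact natDegree_add_le_of_degree_le (hRd j) ((natDegree_C_mul_le _ _).trans (hWd i₀ j))
    · rw [expMoment_add_C_mul]
      exact dvd_add hR0 ((hW0 i₀).mul_left _)
    · rw [expMoment_add_C_mul]
      exact dvd_add hR1 ((hW1 i₀).mul_left _)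
    · rw [expMoment_add_C_mul, dvd_add_right hR2]
      have hunit : IsUnit (((q : ℤ) ^ 2 : ℤ) : PowerSeries ℚ) := by
        rw [← map_intCast (algebraMap ℚ (PowerSeries ℚ))]
        refine IsUnit.map _ (IsUnit.mk0 _ ?_)
        exact_mod_cast pow_ne_zero 2 hq.ne_zero
      rwa [hunit.dvd_mul_left]
    · rw [eval_add, hRN, eval_mul, eval_C, add_sub_cancel_left]
      exact dvd_mul_right _ _
  · refine ⟨R, N, q, c, hN, hq, by omega, hqc, hRd, hR0, hR1, hR2, fun j => ?_⟩
    rw [hRN, sub_self]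
    exact dvd_zero _

theorem norm_sub_le_max_of_ultrametric {K : Type*} [NormedField K] [IsUltrametricDist K]
    (x y : K) : ‖x - y‖ ≤ max ‖x‖ ‖y‖ := by
  simpa [sub_eq_add_neg] using IsUltrametricDist.norm_add_le_max x (-y)

theorem norm_coeff_mul_pow_lt_of_lt_roots {K : Type*} [NormedField K] [IsUltrametricDist K]
    [IsAlgClosed K] {g : K[X]} (hg : g ≠ 0) {δ : ℝ} (hδ : 0 < δ)
    (h : ∀ y, g.IsRoot y → δ < ‖y‖) (i : ℕ) :
    ‖g.coeff (i + 1)‖ * δ ^ (i + 1) < ‖g.coeff 0‖ := by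
  have aux (s : Multiset K) (hs : ∀ y ∈ s, δ < ‖y‖) :
      (s.map fun y => X - C y).prod.coeff 0 ≠ 0 ∧
      ∀ i, ‖(s.map fun y => X - C y).prod.coeff (i + 1)‖ * δ ^ (i + 1) <
        ‖(s.map fun y => X - C y).prod.coeff 0‖ := by
    induction s using Multiset.induction_on with
    | empty => simp [coeff_one]
    | cons r s ih =>
      obtain ⟨h0, hi⟩ := ih fun y hy => hs y (Multiset.mem_cons_of_mem hy)
      have hr : δ < ‖r‖ := hs r (Multiset.mem_cons_self r s)
      rw [Multiset.map_cons, Multiset.prod_cons]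
      set b := (s.map fun y => X - C y).prod with hb
      have h0' : ((X - C r) * b).coeff 0 = -r * b.coeff 0 := by simp [mul_coeff_zero]
      have hbpos : 0 < ‖b.coeff 0‖ := norm_pos_iff.mpr h0
      refine ⟨?_, fun i => ?_⟩
      · rw [h0']
        exact mul_ne_zero (neg_ne_zero.mpr (norm_pos_iff.mp (hδ.trans hr))) h0
      · have hle : ‖b.coeff i‖ * δ ^ i ≤ ‖b.coeff 0‖ := by
          rcases i with _ | i
          · simp
          · exact (hi i).le
        rw [h0', norm_mul, norm_neg, sub_mul, coeff_sub, coeff_X_mul, coeff_C_mul]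
        have hmax := norm_sub_le_max_of_ultrametric (b.coeff i) (r * b.coeff (i + 1))
        refine (mul_le_mul_of_nonneg_right hmax (by positivity)).trans_lt ?_
        rw [max_mul_of_nonneg _ _ (by positivity), max_lt_iff]
        constructor
        · calc ‖b.coeff i‖ * δ ^ (i + 1) = ‖b.coeff i‖ * δ ^ i * δ := by ring
            _ ≤ ‖b.coeff 0‖ * δ := by gcongr
            _ < ‖r‖ * ‖b.coeff 0‖ := by rw [mul_comm]; gcongr
        · rw [norm_mul, mul_assoc]
          exact mul_lt_mul_of_pos_left (hi i) (hδ.trans hr)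
  have hprod := (IsAlgClosed.splits g).eq_prod_roots
  obtain ⟨-, h1⟩ := aux g.roots fun y hy => h y (isRoot_of_mem_roots hy)
  rw [hprod, coeff_C_mul, coeff_C_mul, norm_mul, norm_mul, mul_assoc]
  exact mul_lt_mul_of_pos_left (h1 i) (norm_pos_iff.mpr (leadingCoeff_ne_zero.mpr hg))

theorem exists_two_small_roots {K : Type*} [NormedField K] [IsUltrametricDist K]
    [IsAlgClosed K] {f : K[X]} {δ : ℝ} (hδ : 0 < δ) (h2 : f.coeff 2 ≠ 0)
    (h0 : ‖f.coeff 0‖ ≤ δ ^ 2 * ‖f.coeff 2‖) (h1 : ‖f.coeff 1‖ ≤ δ * ‖f.coeff 2‖) :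
    ∃ y₁ y₂ : K, ‖y₁‖ ≤ δ ∧ ‖y₂‖ ≤ δ ∧ (X - C y₁) * (X - C y₂) ∣ f := by
  have hf : f ≠ 0 := fun h => h2 (by simp [h])
  obtain ⟨y₁, hy₁, hy₁δ⟩ : ∃ y, f.IsRoot y ∧ ‖y‖ ≤ δ := by
    by_contra! h
    have := norm_coeff_mul_pow_lt_of_lt_roots hf hδ h 1
    norm_num at this
    linarith
  obtain ⟨g, rfl⟩ := dvd_iff_isRoot.mpr hy₁
  have hg : g ≠ 0 := right_ne_zero_of_mul hf
  obtain ⟨y₂, hy₂, hy₂δ⟩ : ∃ y, g.IsRoot y ∧ ‖y‖ ≤ δ := by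
    by_contra! h
    have hb1 := norm_coeff_mul_pow_lt_of_lt_roots hg hδ h 0
    have hb2 := norm_coeff_mul_pow_lt_of_lt_roots hg hδ h 1
    simp only [zero_add, pow_one, Nat.reduceAdd] at hb1 hb2
    have hc1 : ((X - C y₁) * g).coeff 1 = g.coeff 0 - y₁ * g.coeff 1 := by
      rw [sub_mul, coeff_sub, coeff_X_mul, coeff_C_mul]
    have hc2 : ((X - C y₁) * g).coeff 2 = g.coeff 1 - y₁ * g.coeff 2 := by
      rw [sub_mul, coeff_sub, coeff_X_mul, coeff_C_mul]
    have hsmall : ‖y₁ * g.coeff 1‖ < ‖g.coeff 0‖ := by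
      rw [norm_mul]
      nlinarith [norm_nonneg (g.coeff 1)]
    have hn1 : ‖((X - C y₁) * g).coeff 1‖ = ‖g.coeff 0‖ := by
      rw [hc1, sub_eq_add_neg, IsUltrametricDist.norm_add_eq_max_of_norm_ne_norm, norm_neg,
        max_eq_left hsmall.le]
      rw [norm_neg]
      exact hsmall.ne'
    have hn2 : ‖((X - C y₁) * g).coeff 2‖ * δ < ‖g.coeff 0‖ := by
      rw [hc2]
      have hmax := norm_sub_le_max_of_ultrametric (g.coeff 1) (y₁ * g.coeff 2)
      refine (mul_le_mul_of_nonneg_right hmax hδ.le).trans_lt ?_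
      rw [max_mul_of_nonneg _ _ hδ.le, max_lt_iff, norm_mul]
      refine ⟨hb1, lt_of_le_of_lt ?_ hb2⟩
      calc ‖y₁‖ * ‖g.coeff 2‖ * δ ≤ δ * ‖g.coeff 2‖ * δ := by gcongr
        _ = ‖g.coeff 2‖ * δ ^ 2 := by ring
    linarith
  exact ⟨y₁, y₂, hy₁δ, hy₂δ, mul_dvd_mul_left _ (dvd_iff_isRoot.mpr hy₂)⟩

theorem irreducible_primPart_of_eisenstein {P : ℤ[X]} {q : ℕ} (hq : q.Prime)
    (hdeg : 0 < P.natDegree) (hlead : ¬ (q : ℤ) ∣ P.leadingCoeff)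
    (hdvd : ∀ i < P.natDegree, (q : ℤ) ∣ P.coeff i) (h0 : ¬ (q : ℤ) ^ 2 ∣ P.coeff 0) :
    Irreducible P.primPart := by
  have hqZ : Prime (q : ℤ) := Nat.prime_iff_prime_int.mp hq
  have hcoeff (i : ℕ) : P.coeff i = P.content * P.primPart.coeff i := by
    conv_lhs => rw [P.eq_C_content_mul_primPart]
    rw [coeff_C_mul]
  have hlead' : P.leadingCoeff = P.content * P.primPart.leadingCoeff := by
    rw [leadingCoeff, hcoeff, leadingCoeff, natDegree_primPart]
  have hcont : ¬ (q : ℤ) ∣ P.content := fun h => hlead (hlead' ▸ h.mul_right _)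
  have hpos : 0 < P.primPart.natDegree := by rwa [natDegree_primPart]
  refine irreducible_of_eisenstein_criterion (P := Ideal.span {(q : ℤ)})
    ((Ideal.span_singleton_prime hqZ.ne_zero).mpr hqZ) ?_ ?_ ?_ ?_ P.isPrimitive_primPart
  · rw [Ideal.mem_span_singleton]
    exact fun h => hlead (hlead' ▸ h.mul_left _)
  · intro i hi
    rw [Ideal.mem_span_singleton]
    have hi' : i < P.natDegree := by
      rw [← natDegree_primPart]
      exact coe_lt_degree.mp hi
    exact (hqZ.dvd_or_dvd (hcoeff i ▸ hdvd i hi')).resolve_left hcont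
  · exact natDegree_pos_iff_degree_pos.mp hpos
  · rw [Ideal.span_singleton_pow, Ideal.mem_span_singleton]
    exact fun h => h0 (hcoeff 0 ▸ h.mul_left _)

theorem exists_norm_aeval_le {p : ℕ} [Fact p.Prime] {G : ℚ[X]} {a : ℕ} (h : X ^ a ∣ G) :
    ∃ C : ℝ, 0 < C ∧ ∀ T : ℚ_[p], ‖T‖ ≤ 1 → ‖aeval T G‖ ≤ C * ‖T‖ ^ a := by
  obtain ⟨G, rfl⟩ := h
  refine ⟨∑ i ∈ Finset.range (G.natDegree + 1), ‖algebraMap ℚ ℚ_[p] (G.coeff i)‖ + 1,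
    by positivity, fun T hT => ?_⟩
  rw [map_mul, map_pow, aeval_X, norm_mul, norm_pow, mul_comm]
  refine mul_le_mul_of_nonneg_right ?_ (by positivity)
  rw [aeval_eq_sum_range]
  refine (norm_sum_le _ _).trans (le_add_of_le_of_nonneg (Finset.sum_le_sum fun i _ => ?_)
    zero_le_one)
  rw [Algebra.smul_def, norm_mul, norm_pow]
  exact mul_le_of_le_one_right (norm_nonneg _) (pow_le_one₀ (norm_nonneg _) hT)

theorem exists_le_norm_aeval {p : ℕ} [Fact p.Prime] {G : ℚ[X]} {b : ℕ} (h : ¬ X ^ b ∣ G) :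
    ∃ c : ℝ, 0 < c ∧ ∀ᶠ T : ℚ_[p] in nhds 0, c * ‖T‖ ^ b ≤ ‖aeval T G‖ := by
  have hG : G ≠ 0 := fun h0 => h (h0 ▸ dvd_zero _)
  obtain ⟨G₁, hG₁, hnd⟩ := exists_eq_pow_rootMultiplicity_mul_and_not_dvd G hG 0
  rw [C_0, sub_zero] at hG₁ hnd
  set s := rootMultiplicity 0 G
  have hsb : s ≤ b := by
    by_contra! hlt
    exact h (hG₁ ▸ (pow_dvd_pow _ hlt.le).mul_right _)
  have hne : aeval (0 : ℚ_[p]) G₁ ≠ 0 := by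
    rw [X_dvd_iff] at hnd
    rw [aeval_def, eval₂_at_zero]
    simpa using hnd
  have hpos : 0 < ‖aeval (0 : ℚ_[p]) G₁‖ := norm_pos_iff.mpr hne
  refine ⟨‖aeval (0 : ℚ_[p]) G₁‖ / 2, by positivity, ?_⟩
  have hcont : Continuous fun T : ℚ_[p] => ‖aeval T G₁‖ := (G₁.continuous_aeval).norm
  have hball : ∀ᶠ T : ℚ_[p] in nhds 0, ‖T‖ < 1 := by
    filter_upwards [Metric.ball_mem_nhds (0 : ℚ_[p]) one_pos] with T hT
    simpa using hT
  filter_upwards [hcont.continuousAt.eventually (lt_mem_nhds (half_lt_self hpos)), hball]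
    with T hT hT1
  rw [hG₁, map_mul, map_pow, aeval_X, norm_mul, norm_pow, mul_comm]
  exact mul_le_mul (pow_le_pow_of_le_one (norm_nonneg _) hT1.le hsb) hT.le (by positivity)
    (by positivity)

/-- The polynomial `∑ j, ω j ^ l * A j (t) * E (t) ^ ω j` obtained from `expMoment ω l A` on
replacing `exp t` by its Taylor polynomial `E` modulo `t ^ K`. -/
noncomputable def truncExpMoment {ι : Type*} [Fintype ι] (K : ℕ) (ω : ι → ℕ) (l : ℕ)
    (A : ι → ℤ[X]) : ℚ[X] :=
  ∑ j, (ω j : ℚ[X]) ^ l * (A j).map (Int.castRingHom ℚ) *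
    PowerSeries.trunc K (PowerSeries.exp ℚ) ^ ω j

theorem X_pow_dvd_truncExpMoment_iff {ι : Type*} [Fintype ι] {K a : ℕ} (ha : a ≤ K) (ω : ι → ℕ)
    (l : ℕ) (A : ι → ℤ[X]) :
    X ^ a ∣ truncExpMoment K ω l A ↔ PowerSeries.X ^ a ∣ expMoment ω l A := by
  have hE : PowerSeries.X ^ K ∣
      (PowerSeries.trunc K (PowerSeries.exp ℚ) : PowerSeries ℚ) - PowerSeries.exp ℚ := by
    rw [PowerSeries.X_pow_dvd_iff]
    intro m hm
    rw [map_sub, PowerSeries.coeff_coe_trunc_of_lt hm, sub_self]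
  have hdiff : PowerSeries.X ^ a ∣
      (truncExpMoment K ω l A : PowerSeries ℚ) - expMoment ω l A := by
    have hcoe : (truncExpMoment K ω l A : PowerSeries ℚ) = ∑ j, (ω j : PowerSeries ℚ) ^ l *
        toRatSeries (A j) * (PowerSeries.trunc K (PowerSeries.exp ℚ) : PowerSeries ℚ) ^ ω j := by
      rw [truncExpMoment, ← coeToPowerSeries.ringHom_apply, map_sum]
      refine Finset.sum_congr rfl fun j _ => ?_
      simp only [map_mul, map_pow, map_natCast]
      rfl
    rw [hcoe, expMoment, ← Finset.sum_sub_distrib]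
    refine Finset.dvd_sum fun j _ => ?_
    rw [← mul_sub]
    exact (((pow_dvd_pow _ ha).trans hE).trans (sub_dvd_pow_sub_pow _ _ _)).mul_left _
  rw [← dvd_iff_dvd_of_dvd_sub hdiff, PowerSeries.X_pow_dvd_iff, Polynomial.X_pow_dvd_iff]
  simp

/-- The integer polynomial `∑ j, A j (t) X ^ j`. -/
noncomputable def specialize {n : ℕ} (A : Fin (n + 1) → ℤ[X]) (t : ℤ) : ℤ[X] :=
  ∑ j : Fin (n + 1), C ((A j).eval t) * X ^ (j : ℕ)

theorem coeff_specialize {n : ℕ} (A : Fin (n + 1) → ℤ[X]) (t : ℤ) (j : Fin (n + 1)) :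
    (specialize A t).coeff j = (A j).eval t := by
  simp [specialize, finsetSum_coeff, coeff_X_pow, Fin.val_inj]

theorem natDegree_specialize_le {n : ℕ} (A : Fin (n + 1) → ℤ[X]) (t : ℤ) :
    (specialize A t).natDegree ≤ n :=
  natDegree_sum_le_of_forall_le _ _ fun j _ => (natDegree_C_mul_X_pow_le _ _).trans (by omega)

theorem coeff_specialize_comp {n : ℕ} (A : Fin (n + 1) → ℤ[X]) (t : ℤ) {F : Type*} [Field F]
    (x : F) (l : ℕ) :
    (((specialize A t).map (Int.castRingHom F)).comp (C x * (X + 1))).coeff l =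
      ∑ j : Fin (n + 1), (((j : ℕ).choose l : ℕ) : F) * (((A j).eval t : ℤ) : F) * x ^ (j : ℕ) := by
  simp only [specialize, Polynomial.map_sum, Polynomial.map_mul, map_C, Polynomial.map_pow, map_X,
    sum_comp, mul_comp, C_comp, pow_comp, X_comp, mul_pow, finsetSum_coeff, ← C_pow,
    coeff_C_mul, coeff_X_add_one_pow]
  refine Finset.sum_congr rfl fun j _ => ?_
  rw [eq_intCast]
  ring

theorem aeval_truncExpMoment {ι : Type*} [Fintype ι] (K : ℕ) (ω : ι → ℕ) (l : ℕ) (A : ι → ℤ[X])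
    {F : Type*} [Field F] [Algebra ℚ F] (t : ℤ) :
    aeval (t : F) (truncExpMoment K ω l A) = ∑ j, (ω j : F) ^ l * (((A j).eval t : ℤ) : F) *
      aeval (t : F) (PowerSeries.trunc K (PowerSeries.exp ℚ)) ^ ω j := by
  rw [truncExpMoment, map_sum]
  refine Finset.sum_congr rfl fun j _ => ?_
  rw [map_mul, map_mul, map_pow, map_pow, map_natCast, ← algebraMap_int_eq, aeval_map_algebraMap]
  congr 2
  rw [← eq_intCast (algebraMap ℤ F), ← eq_intCast (algebraMap ℤ F), aeval_algebraMap_apply,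
    coe_aeval_eq_eval]

theorem exists_close_roots_specialize {p : ℕ} [Fact p.Prime] {L : Type*} [NormedField L]
    [IsUltrametricDist L] [Algebra ℚ_[p] L] [IsAlgClosed L]
    (hL : ∀ y : ℚ_[p], ‖algebraMap ℚ_[p] L y‖ = ‖y‖) {n k : ℕ} (hk : 3 * n + 1 ≤ k)
    (A : Fin (n + 1) → ℤ[X])
    (h0 : PowerSeries.X ^ (2 * k - n) ∣ expMoment (fun j : Fin (n + 1) => (j : ℕ)) 0 A)
    (h1 : PowerSeries.X ^ (k - n) ∣ expMoment (fun j : Fin (n + 1) => (j : ℕ)) 1 A)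
    (h2 : ¬ PowerSeries.X ^ (2 * n + 1) ∣ expMoment (fun j : Fin (n + 1) => (j : ℕ)) 2 A) :
    ∃ D : ℝ, 0 < D ∧ ∀ᶠ T : ℚ_[p] in nhds 0, ∀ t : ℤ, (t : ℚ_[p]) = T → t ≠ 0 →
      (∀ α : L, aeval α (specialize A t) = 0 → aeval α (derivative (specialize A t)) ≠ 0) →
      ∃ α β : L, α ≠ β ∧ aeval α (specialize A t) = 0 ∧ aeval β (specialize A t) = 0 ∧
        ‖α - β‖ ≤ D * ‖T‖ ^ (k - 3 * n - 1) := by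
  set ω : Fin (n + 1) → ℕ := fun j => (j : ℕ) with hω
  set K := 2 * k with hK
  rw [← X_pow_dvd_truncExpMoment_iff (K := K) (by omega)] at h0 h1 h2
  have hdiff : ¬ X ^ (2 * n + 1) ∣ truncExpMoment K ω 2 A - truncExpMoment K ω 1 A := fun h =>
    h2 ((dvd_sub_left ((pow_dvd_pow X (by omega)).trans h1)).mp h)
  obtain ⟨C₀, hC₀, hb0⟩ := exists_norm_aeval_le (p := p) h0
  obtain ⟨C₁, hC₁, hb1⟩ := exists_norm_aeval_le (p := p) h1
  obtain ⟨c, hc, hb2⟩ := exists_le_norm_aeval (p := p) hdiff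
  obtain ⟨Cx, hCx, hbx⟩ := exists_norm_aeval_le (p := p) (a := 0)
    (G := PowerSeries.trunc K (PowerSeries.exp ℚ)) (by simp)
  set M : ℝ := 1 + (C₀ + C₁) / c with hM
  have hM1 : 1 ≤ M := by rw [hM]; linarith [div_pos (add_pos hC₀ hC₁) hc]
  have hMc : C₀ + C₁ ≤ M * c := by
    rw [hM, add_mul, div_mul_cancel₀ _ hc.ne']
    linarith
  refine ⟨Cx * M, by positivity, ?_⟩
  filter_upwards [hb2, Metric.ball_mem_nhds (0 : ℚ_[p]) one_pos] with T hT2 hTball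
  rintro t rfl ht hsep
  set T : ℚ_[p] := (t : ℚ_[p]) with hT
  have hTle : ‖T‖ ≤ 1 := (mem_ball_zero_iff.mp hTball).le
  have hTpos : 0 < ‖T‖ := norm_pos_iff.mpr (by rw [hT]; exact_mod_cast ht)
  set x : ℚ_[p] := aeval T (PowerSeries.trunc K (PowerSeries.exp ℚ)) with hx
  set f : ℚ_[p][X] := ((specialize A t).map (Int.castRingHom ℚ_[p])).comp (C x * (X + 1)) with hf
  have hf0 : f.coeff 0 = aeval T (truncExpMoment K ω 0 A) := by
    rw [hf, coeff_specialize_comp, aeval_truncExpMoment]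
    simp [ω, hx, hT]
  have hf1 : f.coeff 1 = aeval T (truncExpMoment K ω 1 A) := by
    rw [hf, coeff_specialize_comp, aeval_truncExpMoment]
    simp [ω, hx, hT]
  have hf2 : 2 * f.coeff 2 =
      aeval T (truncExpMoment K ω 2 A - truncExpMoment K ω 1 A) := by
    rw [map_sub, hf, coeff_specialize_comp, aeval_truncExpMoment, aeval_truncExpMoment,
      Finset.mul_sum, ← Finset.sum_sub_distrib]
    refine Finset.sum_congr rfl fun j _ => ?_
    rw [Nat.cast_choose_two]
    simp only [ω, ← hx, ← hT]
    ring
  have hc2 : c * ‖T‖ ^ (2 * n + 1) ≤ ‖f.coeff 2‖ := by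
    refine hT2.trans ?_
    rw [← hf2, norm_mul]
    exact mul_le_of_le_one_left (norm_nonneg _) (by exact_mod_cast Padic.norm_int_le_one 2)
  have hc2pos : 0 < ‖f.coeff 2‖ := lt_of_lt_of_le (by positivity) hc2
  set δ : ℝ := M * ‖T‖ ^ (k - 3 * n - 1) with hδ
  have hδpos : 0 < δ := by positivity
  have hδc : C₁ * ‖T‖ ^ (k - n) ≤ δ * ‖f.coeff 2‖ := by
    calc C₁ * ‖T‖ ^ (k - n) ≤ (M * c) * ‖T‖ ^ (k - n) := by gcongr; linarith
      _ = δ * (c * ‖T‖ ^ (2 * n + 1)) := by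
          rw [hδ, show k - n = (k - 3 * n - 1) + (2 * n + 1) by omega, pow_add]
          ring
      _ ≤ δ * ‖f.coeff 2‖ := by gcongr
  have hδ2c : C₀ * ‖T‖ ^ (2 * k - n) ≤ δ ^ 2 * ‖f.coeff 2‖ := by
    calc C₀ * ‖T‖ ^ (2 * k - n) ≤ (M * (M * c)) * ‖T‖ ^ (2 * (k - 3 * n - 1) + (2 * n + 1)) := by
          refine mul_le_mul ?_ (pow_le_pow_of_le_one hTpos.le hTle (by omega)) (by positivity)
            (by positivity)
          nlinarith
      _ = δ ^ 2 * (c * ‖T‖ ^ (2 * n + 1)) := by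
          rw [hδ, pow_add, pow_mul']
          ring
      _ ≤ δ ^ 2 * ‖f.coeff 2‖ := by gcongr
  set fL : L[X] := f.map (algebraMap ℚ_[p] L) with hfL
  have hnorm (i : ℕ) : ‖fL.coeff i‖ = ‖f.coeff i‖ := by rw [hfL, coeff_map, hL]
  obtain ⟨y₁, y₂, hy₁, hy₂, hdvd⟩ := exists_two_small_roots (f := fL) hδpos
    (norm_pos_iff.mp (by rwa [hnorm]))
    (by rw [hnorm, hnorm, hf0]; exact (hb0 T hTle).trans hδ2c)
    (by rw [hnorm, hnorm, hf1]; exact (hb1 T hTle).trans hδc)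
  set xL : L := algebraMap ℚ_[p] L x with hxL
  have hfLeq : fL = ((specialize A t).map (Int.castRingHom L)).comp (C xL * (X + 1)) := by
    rw [hfL, hf, map_comp, map_map]
    simp only [Polynomial.map_mul, map_C, Polynomial.map_add, map_X, Polynomial.map_one, ← hxL]
    congr 2
    exact RingHom.ext_int _ _
  have heval (y : L) : fL.eval y = aeval (xL * (y + 1)) (specialize A t) := by
    rw [hfLeq, eval_comp, eval_map, aeval_def]
    simp [algebraMap_int_eq]
  have hderiv (y : L) : (derivative fL).eval y =
      xL * aeval (xL * (y + 1)) (derivative (specialize A t)) := by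
    rw [hfLeq, derivative_comp, eval_mul, eval_comp, derivative_map, eval_map, aeval_def]
    simp [algebraMap_int_eq]
  have hr₁ : fL.eval y₁ = 0 := dvd_iff_isRoot.mp ((dvd_mul_right _ _).trans hdvd)
  have hr₂ : fL.eval y₂ = 0 := dvd_iff_isRoot.mp ((dvd_mul_left _ _).trans hdvd)
  have hxne : xL ≠ 0 := fun h0 => by
    have : fL.coeff 2 = 0 := by
      rw [hfLeq, h0, C_0, zero_mul, comp_zero, coeff_C]
      simp
    rw [← hnorm, this, norm_zero] at hc2pos
    exact hc2pos.false
  refine ⟨xL * (y₁ + 1), xL * (y₂ + 1), fun heq => ?_, by rw [← heval, hr₁],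
    by rw [← heval, hr₂], ?_⟩
  · have hyy : y₁ = y₂ := add_right_cancel (mul_left_cancel₀ hxne heq)
    subst hyy
    refine hsep (xL * (y₁ + 1)) (by rw [← heval, hr₁]) ?_
    have hd0 : (derivative fL).eval y₁ = 0 := by
      obtain ⟨g, hg⟩ := hdvd
      rw [hg]
      simp [derivative_mul]
    rw [hderiv] at hd0
    exact (mul_eq_zero.mp hd0).resolve_left hxne
  · have hxn : ‖xL‖ ≤ Cx := by
      rw [hxL, hL]
      simpa using hbx T hTle
    rw [← mul_sub, norm_mul, mul_assoc]
    refine mul_le_mul hxn ?_ (norm_nonneg _) hCx.le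
    rw [add_sub_add_right_eq_sub]
    exact (norm_sub_le_max_of_ultrametric _ _).trans (max_le hy₁ hy₂)

theorem natAbs_coeff_le_polyHeight (P : ℤ[X]) (i : ℕ) : (P.coeff i).natAbs ≤ polyHeight P := by
  by_cases hi : i ≤ P.natDegree
  · exact Finset.le_sup (f := fun i => (P.coeff i).natAbs) (Finset.mem_range.mpr (by omega))
  · simp [coeff_eq_zero_of_natDegree_lt (not_le.mp hi)]

theorem one_le_polyHeight {P : ℤ[X]} (hP : P ≠ 0) : 1 ≤ polyHeight P :=
  (Int.natAbs_pos.mpr (leadingCoeff_ne_zero.mpr hP)).trans_le (natAbs_coeff_le_polyHeight P _)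

theorem polyHeight_primPart_le {P : ℤ[X]} (hP : P ≠ 0) : polyHeight P.primPart ≤ polyHeight P := by
  refine Finset.sup_le fun i _ => le_trans ?_ (natAbs_coeff_le_polyHeight P i)
  nth_rewrite 2 [P.eq_C_content_mul_primPart]
  rw [coeff_C_mul, Int.natAbs_mul]
  exact Nat.le_mul_of_pos_left _ (Int.natAbs_pos.mpr (mt content_eq_zero_iff.mp hP))

theorem aeval_derivative_ne_zero_of_irreducible_primPart {P : ℤ[X]} (hirr : Irreducible P.primPart)
    (hdeg : 0 < P.natDegree) {F : Type*} [Field F] [CharZero F] {α : F} (hα : aeval α P = 0) :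
    aeval α (derivative P) ≠ 0 := by
  have hP : P ≠ 0 := fun h => by simp [h] at hdeg
  have hirrQ : Irreducible (P.primPart.map (algebraMap ℤ ℚ)) :=
    (IsPrimitive.Int.irreducible_iff_irreducible_map_cast P.isPrimitive_primPart).mp hirr
  have hα' : aeval α (P.primPart.map (algebraMap ℤ ℚ)) = 0 := by
    rw [aeval_map_algebraMap]
    exact aeval_primPart_eq_zero hP hα
  have hne := hirrQ.separable.aeval_derivative_ne_zero hα'
  rw [derivative_map, aeval_map_algebraMap] at hne
  have hc : ((P.content : ℤ) : F) ≠ 0 := by exact_mod_cast mt content_eq_zero_iff.mp hP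
  rw [P.eq_C_content_mul_primPart, derivative_C_mul, map_mul, aeval_C, eq_intCast]
  exact mul_ne_zero hc hne

theorem exists_pos_le_norm_sub_of_polyHeight_lt (L : Type*) [NormedField L] [CharZero L] (n : ℕ)
    (H : ℝ) :
    ∃ ε : ℝ, 0 < ε ∧ ∀ P : ℤ[X], P ≠ 0 → P.natDegree ≤ n → (polyHeight P : ℝ) < H →
      ∀ α β : L, α ≠ β → aeval α P = 0 → aeval β P = 0 → ε ≤ ‖α - β‖ := by
  classical
  have hfin := bUnion_roots_finite (algebraMap ℤ L) n (Set.finite_Icc (-⌈H⌉) ⌈H⌉)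
  set Z : Set L := _
  change Z.Finite at hfin
  have hmem {P : ℤ[X]} (hP : P ≠ 0) (hdeg : P.natDegree ≤ n) (hH : (polyHeight P : ℝ) < H) {α : L}
      (hα : aeval α P = 0) : α ∈ Z := by
    simp only [Z, Set.mem_iUnion]
    refine ⟨P, ⟨hdeg, fun i => ?_⟩, ?_⟩
    · have h1 : ((P.coeff i).natAbs : ℝ) < H :=
        lt_of_le_of_lt (by exact_mod_cast natAbs_coeff_le_polyHeight P i) hH
      have h2 : ((P.coeff i).natAbs : ℤ) ≤ ⌈H⌉ := by
        rw [← Int.cast_le (R := ℝ), Int.cast_natCast]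
        exact h1.le.trans (Int.le_ceil H)
      rw [Int.natCast_natAbs, abs_le] at h2
      exact h2
    · have hP' : P.map (algebraMap ℤ L) ≠ 0 :=
        (Polynomial.map_ne_zero_iff (RingHom.injective_int _)).mpr hP
      rw [Finset.mem_coe, Multiset.mem_toFinset, mem_roots hP', IsRoot, eval_map_algebraMap]
      exact hα
  by_cases hZ : Z.Nontrivial
  · refine ⟨Z.infsep, hfin.infsep_pos_iff_nontrivial.mpr hZ, fun P hP hd hH α β hne hα hβ => ?_⟩
    rw [← dist_eq_norm]
    exact Set.infsep_le_dist_of_mem (hmem hP hd hH hα) (hmem hP hd hH hβ) hne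
  · exact ⟨1, one_pos, fun P hP hd hH α β hne hα hβ =>
      absurd ⟨α, hmem hP hd hH hα, β, hmem hP hd hH hβ, hne⟩ hZ⟩

theorem exists_abs_eval_le {P : ℤ[X]} {d : ℕ} (hP : P.natDegree ≤ d) :
    ∃ C : ℕ, ∀ t : ℤ, t ≠ 0 → (P.eval t).natAbs ≤ C * t.natAbs ^ d := by
  refine ⟨∑ i ∈ Finset.range (d + 1), (P.coeff i).natAbs, fun t ht => ?_⟩
  rw [eval_eq_sum_range' (Nat.lt_succ_of_le hP), Finset.sum_mul]
  refine (Int.natAbs_sum_le _ _).trans (Finset.sum_le_sum fun i hi => ?_)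
  rw [Int.natAbs_mul, Int.natAbs_pow]
  exact Nat.mul_le_mul_left _
    (Nat.pow_le_pow_right (Int.natAbs_pos.mpr ht) (Nat.lt_succ_iff.mp (Finset.mem_range.mp hi)))

theorem exists_polyHeight_specialize_le {n d : ℕ} {A : Fin (n + 1) → ℤ[X]}
    (hA : ∀ j, (A j).natDegree ≤ d) :
    ∃ C : ℕ, ∀ t : ℤ, t ≠ 0 → polyHeight (specialize A t) ≤ C * t.natAbs ^ d := by
  choose C hC using fun j => exists_abs_eval_le (hA j)
  refine ⟨∑ j, C j, fun t ht => Finset.sup_le fun i hi => ?_⟩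
  have hin : i < n + 1 := (Finset.mem_range.mp hi).trans_le
    (Nat.succ_le_succ (natDegree_specialize_le A t))
  have := coeff_specialize A t ⟨i, hin⟩
  rw [show (specialize A t).coeff i = (A ⟨i, hin⟩).eval t from this]
  refine (hC _ t ht).trans (Nat.mul_le_mul_right _ ?_)
  exact Finset.single_le_sum (f := C) (fun _ _ => Nat.zero_le _) (Finset.mem_univ _)

theorem eisenstein_specialize {n N q : ℕ} {c t : ℤ} {B : Fin (n + 1) → ℤ[X]} (hn : n ≠ 0)
    (hq : q.Prime) (hc : ¬ (q : ℤ) ∣ c) (ht : (q : ℤ) ^ 2 ∣ t - N)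
    (hB : ∀ j, (q : ℤ) ^ 2 ∣ (B j).eval (N : ℤ) -
      c * (if j = 0 then (q : ℤ) else if j = Fin.last n then 1 else 0)) :
    (specialize B t).natDegree = n ∧ Irreducible (specialize B t).primPart := by
  have hqZ : Prime (q : ℤ) := Nat.prime_iff_prime_int.mp hq
  have hcoeff (j : Fin (n + 1)) : (q : ℤ) ^ 2 ∣ (specialize B t).coeff j -
      c * (if j = 0 then (q : ℤ) else if j = Fin.last n then 1 else 0) := by
    rw [coeff_specialize]
    have := dvd_add (ht.trans (sub_dvd_eval_sub t N (B j))) (hB j)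
    rwa [sub_add_sub_cancel] at this
  have hqq : (q : ℤ) ∣ (q : ℤ) ^ 2 := dvd_pow_self _ two_ne_zero
  have hlast : ¬ (q : ℤ) ∣ (specialize B t).coeff n := by
    have h := hqq.trans (hcoeff (Fin.last n))
    rw [if_neg (by simpa [Fin.ext_iff] using hn), if_pos rfl, mul_one, Fin.val_last] at h
    exact fun h' => hc ((dvd_sub_right h').mp h)
  have hdeg : (specialize B t).natDegree = n :=
    (natDegree_specialize_le B t).antisymm
      (le_natDegree_of_ne_zero fun h => hlast (h ▸ dvd_zero _))
  refine ⟨hdeg, irreducible_primPart_of_eisenstein hq (by omega) ?_ (fun i hi => ?_) fun h => ?_⟩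
  · rwa [leadingCoeff, hdeg]
  · have h := hqq.trans (hcoeff ⟨i, by omega⟩)
    refine (dvd_sub_left ?_).mp h
    refine Dvd.dvd.mul_left ?_ c
    split_ifs with h0 h1
    · exact dvd_rfl
    · simp only [Fin.ext_iff, Fin.val_last] at h1
      omega
    · exact dvd_zero _
  · have h' := hcoeff 0
    rw [if_pos rfl, Fin.val_zero] at h'
    have h2 := (dvd_sub_right h).mp h'
    rw [pow_two] at h2
    exact hc (Int.dvd_of_mul_dvd_mul_right hqZ.ne_zero h2)

theorem eventually_mul_inv_pow_le_rpow_neg {u C D e : ℝ} {d s : ℕ} (hu : 1 < u) (hC : 0 < C)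
    (hD : 0 < D) (he : 0 < e) (hs : d * e < s) :
    ∀ᶠ m : ℕ in Filter.atTop, ∀ H : ℝ, 1 ≤ H → H ≤ C * (u ^ m) ^ d →
      D * ((u ^ m)⁻¹) ^ s ≤ H ^ (-e) := by
  have hy : Filter.Tendsto (fun m : ℕ => (u ^ m) ^ ((s : ℝ) - d * e)) Filter.atTop Filter.atTop :=
    (tendsto_rpow_atTop (sub_pos.mpr hs)).comp (tendsto_pow_atTop_atTop_of_one_lt hu)
  filter_upwards [hy.eventually_ge_atTop (D * C ^ e)] with m hm H hH1 hH
  have hypos : 0 < u ^ m := pow_pos (one_pos.trans hu) m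
  set y := u ^ m
  have hHpos : 0 < H ^ e := Real.rpow_pos_of_pos (by linarith) e
  have hHe : H ^ e ≤ C ^ e * y ^ (d * e) := by
    calc H ^ e ≤ (C * y ^ d) ^ e := Real.rpow_le_rpow (by linarith) hH he.le
      _ = C ^ e * y ^ (d * e) := by
        rw [Real.mul_rpow hC.le (by positivity), Real.rpow_mul hypos.le, Real.rpow_natCast]
  rw [Real.rpow_neg (by linarith), inv_pow, ← div_eq_mul_inv, ← one_div,
    div_le_div_iff₀ (by positivity) hHpos, one_mul]
  calc D * H ^ e ≤ D * C ^ e * y ^ (d * e) := by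
        rw [mul_assoc]
        gcongr
    _ ≤ y ^ ((s : ℝ) - d * e) * y ^ (d * e) := by gcongr
    _ = y ^ s := by rw [← Real.rpow_add hypos, sub_add_cancel, Real.rpow_natCast]

theorem isUltrametricDist_of_norm_algebraMap_padic {p : ℕ} [Fact p.Prime] {L : Type*}
    [NormedField L] [Algebra ℚ_[p] L] (hL : ∀ y : ℚ_[p], ‖algebraMap ℚ_[p] L y‖ = ‖y‖) :
    IsUltrametricDist L :=
  IsUltrametricDist.isUltrametricDist_of_forall_norm_natCast_le_one fun m => by
    rw [← map_natCast (algebraMap ℚ_[p] L), hL]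
    exact_mod_cast Padic.norm_int_le_one (p := p) m

/-- For every integer `n ≥ 2`, every prime `p`, and every real `e` with
`0 < e < (n+1)/3`, there exist infinitely many irreducible `P ∈ ℤ[X]` of degree `n` (i.e. for
every `H₀ > 0` there is such a `P` with `H(P) ≥ H₀`) having two distinct roots `α ≠ β` in the
algebraic closure of `ℚ_p` with `|α − β|_p ≤ H(P)^{−e}`. In other words, the `p`-adic root
separation exponent for irreducible integer polynomials of degree `n` is at least `(n+1)/3`.

The algebraic closure of `ℚ_p` together with its (unique) extension of the `p`-adic absolute
value is modelled by an algebraically closed normed field `L`, algebraic over `ℚ_p`, whose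
norm restricts to the `p`-adic norm on `ℚ_p`. -/
theorem stmt0 (p : ℕ) [Fact p.Prime] (n : ℕ) (hn : 2 ≤ n)
    (L : Type*) [NormedField L] [Algebra ℚ_[p] L] [IsAlgClosed L]
    [Algebra.IsAlgebraic ℚ_[p] L]
    (hL : ∀ y : ℚ_[p], ‖algebraMap ℚ_[p] L y‖ = ‖y‖)
    (e : ℝ) (he0 : 0 < e) (he1 : e < ((n : ℝ) + 1) / 3) :
    ∀ H₀ : ℝ, 0 < H₀ →
      ∃ P : Polynomial ℤ, Irreducible P ∧ P.natDegree = n ∧ H₀ ≤ (polyHeight P : ℝ) ∧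
        ∃ α β : L, α ≠ β ∧
          Polynomial.aeval α P = 0 ∧ Polynomial.aeval β P = 0 ∧
          ‖α - β‖ ≤ (polyHeight P : ℝ) ^ (-e) := by
  have : IsUltrametricDist L := isUltrametricDist_of_norm_algebraMap_padic hL
  have : CharZero L := charZero_of_injective_algebraMap (algebraMap ℚ_[p] L).injective
  have hp : p.Prime := Fact.out
  intro H₀ _
  obtain ⟨r, hr1, hr2⟩ : ∃ r : ℕ, 2 * n + 1 < r ∧ 3 * n + 1 < r * ((n : ℝ) + 1 - 3 * e) := by
    obtain ⟨r, hr⟩ := exists_nat_gt ((3 * n + 1) / ((n : ℝ) + 1 - 3 * e))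
    have hpos : 0 < (n : ℝ) + 1 - 3 * e := by linarith
    refine ⟨max r (2 * n + 2), by omega, ?_⟩
    rw [div_lt_iff₀ hpos] at hr
    refine hr.trans_le ?_
    gcongr
    exact_mod_cast le_max_left _ _
  set k := r * (n + 1) with hk
  set d := 3 * r with hd
  have hkn : 2 * n * (n + 1) + (n + 1) < k := by
    rw [hk, ← Nat.succ_mul]
    exact Nat.mul_lt_mul_of_pos_right hr1 n.succ_pos
  have hk3 : 3 * n + 1 ≤ k := by nlinarith
  have hdk : (n + 1) * d = 3 * k := by rw [hk, hd]; ring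
  obtain ⟨B, N, q, c, hN, hq, hqp, hqc, hBd, h0, h1, h2, hB⟩ :=
    exists_eisenstein_family p hn (by omega : 2 * n * (n + 1) < k) hdk.le
      (by rw [← hdk]; exact Nat.mul_lt_mul_of_pos_left d.lt_succ_self n.succ_pos)
  obtain ⟨D, hD, hroots⟩ := exists_close_roots_specialize (L := L) hL hk3 B h0 h1 h2
  obtain ⟨C, hC⟩ := exists_polyHeight_specialize_le hBd
  obtain ⟨ε, hε, hsep⟩ := exists_pos_le_norm_sub_of_polyHeight_lt L n H₀
  set τ := (q ^ 2).totient with hτ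
  have hτpos : 0 < τ := Nat.totient_pos.mpr (pow_pos hq.pos 2)
  set u : ℝ := (p : ℝ) ^ τ with hu
  have hu1 : 1 < u := one_lt_pow₀ (by exact_mod_cast hp.one_lt) hτpos.ne'
  set s := k - 3 * n - 1 with hs
  have hsR : (s : ℝ) = r * (n + 1) - 3 * n - 1 := by
    rw [hs, Nat.sub_sub, Nat.cast_sub hk3, hk]
    push_cast
    ring
  have hds : d * e < s := by
    rw [hsR, hd]
    push_cast
    linarith
  have hspos : s ≠ 0 := fun h => by
    rw [h, Nat.cast_zero] at hds
    exact absurd hds (not_lt.mpr (by positivity))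
  set t : ℕ → ℤ := fun m => N * (p : ℤ) ^ (τ * m) with ht
  have hinv : Filter.Tendsto (fun m : ℕ => (u ^ m)⁻¹) Filter.atTop (nhds 0) :=
    (tendsto_pow_atTop_atTop_of_one_lt hu1).inv_tendsto_atTop
  have htn (m : ℕ) : ‖(t m : ℚ_[p])‖ ≤ (u ^ m)⁻¹ := by
    have hNn : ‖((N : ℤ) : ℚ_[p])‖ ≤ 1 := Padic.norm_int_le_one _
    rw [ht, Int.cast_mul, Int.cast_pow, norm_mul, norm_pow, Int.cast_natCast p, Padic.norm_p,
      hu, ← pow_mul, inv_pow]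
    exact mul_le_of_le_one_left (by positivity) hNn
  have htlim : Filter.Tendsto (fun m : ℕ => (t m : ℚ_[p])) Filter.atTop (nhds 0) :=
    squeeze_zero_norm htn hinv
  have ht0 (m : ℕ) : t m ≠ 0 :=
    mul_ne_zero (by exact_mod_cast hN.ne') (pow_ne_zero _ (by exact_mod_cast hp.ne_zero))
  have htq (m : ℕ) : (q : ℤ) ^ 2 ∣ t m - N := by
    have hcop : Nat.Coprime p (q ^ 2) := ((Nat.coprime_primes hp hq).mpr hqp.symm).pow_right 2
    have hmod := ((Nat.ModEq.pow_totient hcop).pow m).mul_left N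
    rw [one_pow, mul_one, ← pow_mul] at hmod
    have := (Nat.modEq_iff_dvd.mp hmod.symm)
    push_cast at this
    exact this
  have herr : Filter.Tendsto (fun m : ℕ => D * ((u ^ m)⁻¹) ^ s) Filter.atTop (nhds 0) := by
    simpa [hspos] using (hinv.pow s).const_mul D
  obtain ⟨m, hmroots, hmexp, hmε⟩ := ((htlim.eventually hroots).and
    ((eventually_mul_inv_pow_le_rpow_neg (C := C * N ^ d + 1) hu1 (by positivity) hD he0 hds).and
      (herr.eventually_lt_const hε))).exists
  obtain ⟨hdeg, hirr⟩ := eisenstein_specialize (by omega) hq hqc (htq m) hB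
  set P := specialize B (t m) with hP
  have hP0 : P ≠ 0 := fun h => by rw [h, natDegree_zero] at hdeg; omega
  obtain ⟨α, β, hne, hα, hβ, hαβ⟩ := hmroots (t m) rfl (ht0 m) fun α hα =>
    aeval_derivative_ne_zero_of_irreducible_primPart hirr (by omega) hα
  have hQdeg : P.primPart.natDegree = n := by rw [natDegree_primPart, hdeg]
  have hQα := aeval_primPart_eq_zero hP0 hα
  have hQβ := aeval_primPart_eq_zero hP0 hβ
  have hαβ' : ‖α - β‖ ≤ D * ((u ^ m)⁻¹) ^ s := hαβ.trans (by gcongr; exact htn m)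
  refine ⟨P.primPart, hirr, hQdeg, ?_, α, β, hne, hQα, hQβ, hαβ'.trans (hmexp _ ?_ ?_)⟩
  · by_contra! hlt
    exact (hmε.trans_le (hsep _ P.primPart_ne_zero hQdeg.le hlt α β hne hQα hQβ)).not_ge hαβ'
  · exact_mod_cast one_le_polyHeight P.primPart_ne_zero
  · have hH : (polyHeight P.primPart : ℝ) ≤ C * (t m).natAbs ^ d := by
      exact_mod_cast (polyHeight_primPart_le hP0).trans (hC (t m) (ht0 m))
    have habs : ((t m).natAbs : ℝ) = N * u ^ m := by
      rw [ht, Int.natAbs_mul, Int.natAbs_pow, Int.natAbs_natCast, Int.natAbs_natCast, hu, ← pow_mul]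
      push_cast
      rfl
    rw [habs, mul_pow, ← mul_assoc] at hH
    refine hH.trans ?_
    gcongr
    linarith
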